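/- arXiv:2505.21147 — 2 statements merged into one kernel-verified Lean document; each statement's English description precedes it below -/
import Mathlib

section
/- Let M, B ≥ 0, δ > 0, and 0 ≤ η, C ≤ 1. Let k : ℝ × ℝ → ℝ satisfy 0 ≤ k(x,y) ≤ B for all x, y, and |k(x,y) − k(x',y')| ≤ M(|x−x'| + |y−y'|) for all x, x', y, y'. Let w : ℝ → ℝ be a nonnegative Lebesgue-integrable function with ∫_ℝ w(α) dα = 1, ∫_{[−δ,δ]} w(α) dα ≤ C, and ∫_{ℝ \ [−δ,δ]} w(α) dα ≤ η. Then for all a, b ∈ ℝ: | ∫_ℝ w(α) · k(a+α, b+α) dα − k(a,b) | ≤ 2Mδ·C + B·η. -/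
open MeasureTheory Set

/-- Kernel perturbation inequality from the proof of Theorem 3 (NNM): if `k` is a jointly
`M`-Lipschitz kernel bounded by `B`, and `w` is a nonnegative integrable weight with total
mass `1`, mass at most `C` on `[−δ,δ]` and mass at most `η` outside `[−δ,δ]`, then for all
`a, b`,
`|∫ w(α) k(a+α, b+α) dα − k(a,b)| ≤ 2MδC + Bη`. -/
theorem kernel_perturbation
    (M B δ η C : ℝ) (hM : 0 ≤ M) (hB : 0 ≤ B) (hδ : 0 < δ)
    (hη0 : 0 ≤ η) (hη1 : η ≤ 1) (hC0 : 0 ≤ C) (hC1 : C ≤ 1)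
    (k : ℝ → ℝ → ℝ)
    (hk0 : ∀ x y, 0 ≤ k x y) (hkB : ∀ x y, k x y ≤ B)
    (hkLip : ∀ x x' y y', |k x y - k x' y'| ≤ M * (|x - x'| + |y - y'|))
    (w : ℝ → ℝ) (hw0 : ∀ α, 0 ≤ w α) (hwint : Integrable w)
    (hw1 : (∫ α, w α) = 1)
    (hwin : (∫ α in Set.Icc (-δ) δ, w α) ≤ C)
    (hwout : (∫ α in (Set.Icc (-δ) δ)ᶜ, w α) ≤ η) :
    ∀ a b : ℝ, |(∫ α, w α * k (a + α) (b + α)) - k a b| ≤ 2 * M * δ * C + B * η := by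
  intro a b
  have hcont : Continuous fun α => k (a + α) (b + α) := by
    refine (LipschitzWith.of_dist_le_mul (K := (2 * M).toNNReal) fun x y => ?_).continuous
    rw [Real.coe_toNNReal _ (by positivity), Real.dist_eq, Real.dist_eq]
    refine (hkLip _ _ _ _).trans_eq ?_
    rw [add_sub_add_left_eq_sub, add_sub_add_left_eq_sub]
    ring
  have hbound (α : ℝ) : |k (a + α) (b + α) - k a b| ≤ B :=
    abs_sub_le_of_nonneg_of_le (hk0 _ _) (hkB _ _) (hk0 _ _) (hkB _ _)
  have hint : Integrable fun α => w α * k (a + α) (b + α) :=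
    hwint.mul_bdd (c := B) hcont.aestronglyMeasurable <| .of_forall fun α => by
      rw [Real.norm_of_nonneg (hk0 _ _)]
      exact hkB _ _
  have habs : Integrable fun α => w α * |k (a + α) (b + α) - k a b| :=
    hwint.mul_bdd (c := B) (hcont.sub continuous_const).abs.aestronglyMeasurable <|
      .of_forall fun α => by
        rw [Real.norm_eq_abs, abs_abs]
        exact hbound α
  have hdiff : (∫ α, w α * k (a + α) (b + α)) - k a b
      = ∫ α, w α * (k (a + α) (b + α) - k a b) := by
    simp_rw [mul_sub]
    rw [integral_sub hint (hwint.mul_const _), integral_mul_const, hw1, one_mul]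
  have hinner : ∫ α in Icc (-δ) δ, w α * |k (a + α) (b + α) - k a b| ≤ 2 * M * δ * C := by
    calc
      _ ≤ ∫ α in Icc (-δ) δ, w α * (2 * M * δ) := by
        refine setIntegral_mono_on habs.integrableOn (hwint.mul_const _).integrableOn
          measurableSet_Icc fun α hα => mul_le_mul_of_nonneg_left ?_ (hw0 α)
        refine (hkLip _ _ _ _).trans ?_
        rw [add_sub_cancel_left, add_sub_cancel_left]
        have : M * |α| ≤ M * δ := mul_le_mul_of_nonneg_left (abs_le.2 hα) hM
        linarith
      _ = 2 * M * δ * ∫ α in Icc (-δ) δ, w α := by rw [integral_mul_const, mul_comm]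
      _ ≤ 2 * M * δ * C := by gcongr
  have houter : ∫ α in (Icc (-δ) δ)ᶜ, w α * |k (a + α) (b + α) - k a b| ≤ B * η := by
    calc
      _ ≤ ∫ α in (Icc (-δ) δ)ᶜ, w α * B :=
        setIntegral_mono habs.integrableOn (hwint.mul_const _).integrableOn
          fun α => mul_le_mul_of_nonneg_left (hbound α) (hw0 α)
      _ = B * ∫ α in (Icc (-δ) δ)ᶜ, w α := by rw [integral_mul_const, mul_comm]
      _ ≤ B * η := by gcongr
  calc
    _ = |∫ α, w α * (k (a + α) (b + α) - k a b)| := by rw [hdiff]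
    _ ≤ ∫ α, |w α * (k (a + α) (b + α) - k a b)| := abs_integral_le_integral_abs
    _ = ∫ α, w α * |k (a + α) (b + α) - k a b| := by simp_rw [abs_mul, abs_of_nonneg (hw0 _)]
    _ = _ := (integral_add_compl measurableSet_Icc habs).symm
    _ ≤ 2 * M * δ * C + B * η := add_le_add hinner houter
end

section
/- Let M, B ≥ 0, δ > 0, 0 ≤ η, C ≤ 1, and let u_0 ≤ u_1 and v_0 ≤ v_1 be real numbers. Let f̃ : ℝ → ℝ be a nonnegative measurable function with ∫_ℝ f̃ = 1 that vanishes outside [u_0, u_1]. Let k : ℝ × ℝ → ℝ satisfy: 0 ≤ k(x,y) ≤ B for all x,y; |k(x,y) − k(x',y')| ≤ M(|x−x'| + |y−y'|) for all x,x',y,y'; for every y, x ↦ k(x,y) vanishes outside [v_0, v_1] and ∫_ℝ k(x,y) dx = 1. Let w : ℝ × ℝ → ℝ be nonnegative and jointly measurable such that for every b ∈ [u_0, u_1]: ∫_ℝ w(α, b) dα = 1, ∫_{[−δ,δ]} w(α, b) dα ≤ C, ∫_{ℝ \ [−δ,δ]} w(α, b) dα ≤ η, and α ↦ w(α, b) vanishes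 outside [u_0 − b, u_1 − b]. Define f_nnm(a) = ∫_ℝ f̃(b) ( ∫_ℝ w(α, b) · k(a+α, b+α) dα ) db and f_s(a) = ∫_ℝ f̃(b) · k(a, b) db. Then for every t ∈ ℝ: | ∫_{−∞}^{t} f_nnm(a) da − ∫_{−∞}^{t} f_s(a) da | ≤ A · ( 2Mδ·C + B·η ), where A = 2(u_1 − u_0) + (v_1 − v_0). -/
open MeasureTheory Set

/-- A probability density integrates functions that are `ε`-close on its support to values
that are `ε`-close. -/
theorem abs_integral_density_mul_sub_le {X : Type*} [MeasurableSpace X] {μ : Measure X}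
    {f g h : X → ℝ} {K ε : ℝ} (hf0 : ∀ x, 0 ≤ f x) (hf1 : ∫ x, f x ∂μ = 1)
    (hfg : AEStronglyMeasurable (fun x => f x * g x) μ)
    (hfh : AEStronglyMeasurable (fun x => f x * h x) μ)
    (hg : ∀ x, f x ≠ 0 → |g x| ≤ K) (hh : ∀ x, f x ≠ 0 → |h x| ≤ K)
    (hgh : ∀ x, f x ≠ 0 → |g x - h x| ≤ ε) :
    |(∫ x, f x * g x ∂μ) - ∫ x, f x * h x ∂μ| ≤ ε := by
  have hfint : Integrable f μ := by
    by_contra hn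
    simp [integral_undef hn] at hf1
  have hmul : ∀ (q : X → ℝ) (D : ℝ), (∀ x, f x ≠ 0 → |q x| ≤ D) →
      ∀ x, ‖f x * q x‖ ≤ f x * D := by
    intro q D hq x
    rw [Real.norm_eq_abs, abs_mul, abs_of_nonneg (hf0 x)]
    by_cases hx : f x = 0
    · simp [hx]
    · exact mul_le_mul_of_nonneg_left (hq x hx) (hf0 x)
  have hgi : Integrable (fun x => f x * g x) μ :=
    (hfint.mul_const K).mono' hfg (ae_of_all _ (hmul g K hg))
  have hhi : Integrable (fun x => f x * h x) μ :=
    (hfint.mul_const K).mono' hfh (ae_of_all _ (hmul h K hh))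
  rw [← integral_sub hgi hhi, ← Real.norm_eq_abs]
  calc ‖∫ x, (f x * g x - f x * h x) ∂μ‖ ≤ ∫ x, f x * ε ∂μ := by
        refine norm_integral_le_of_norm_le (hfint.mul_const ε) (ae_of_all _ fun x => ?_)
        rw [← mul_sub]
        exact hmul (fun x => g x - h x) ε hgh x
    _ = ε := by rw [integral_mul_const, hf1, one_mul]

/-- Averaging `h` against a probability density `w` changes it little from a reference value `c`
when `h` is close to `c` on a set `s` and `w` has little mass off `s`. -/
theorem abs_integral_density_mul_sub_const_le {X : Type*} [MeasurableSpace X] {μ : Measure X}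
    {w h : X → ℝ} {s : Set X} {B L C η c : ℝ} (hs : MeasurableSet s)
    (hw0 : ∀ x, 0 ≤ w x) (hw1 : ∫ x, w x ∂μ = 1) (hh : AEStronglyMeasurable h μ)
    (hL : 0 ≤ L) (hB : 0 ≤ B) (hin : ∫ x in s, w x ∂μ ≤ C) (hout : ∫ x in sᶜ, w x ∂μ ≤ η)
    (hhL : ∀ x ∈ s, |h x - c| ≤ L) (hhB : ∀ x, |h x - c| ≤ B) :
    |(∫ x, w x * h x ∂μ) - c| ≤ L * C + B * η := by
  have hwint : Integrable w μ := by
    by_contra hn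
    simp [integral_undef hn] at hw1
  have hnorm : ∀ x, ‖w x * (h x - c)‖ = w x * |h x - c| := fun x => by
    rw [Real.norm_eq_abs, abs_mul, abs_of_nonneg (hw0 x)]
  have hdi : Integrable (fun x => w x * (h x - c)) μ :=
    (hwint.mul_const B).mono'
      (hwint.aestronglyMeasurable.mul (hh.sub aestronglyMeasurable_const))
      (ae_of_all _ fun x => (hnorm x).trans_le (mul_le_mul_of_nonneg_left (hhB x) (hw0 x)))
  have heq : (∫ x, w x * h x ∂μ) - c = ∫ x, w x * (h x - c) ∂μ := by
    have : ∫ x, w x * h x ∂μ = ∫ x, (w x * (h x - c) + w x * c) ∂μ := by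
      congr 1 with x
      ring
    rw [this, integral_add hdi (hwint.mul_const c), integral_mul_const, hw1]
    ring
  rw [heq, ← integral_add_compl hs hdi]
  refine (abs_add_le _ _).trans (add_le_add ?_ ?_)
  · calc |∫ x in s, w x * (h x - c) ∂μ| ≤ ∫ x in s, w x * L ∂μ := by
          rw [← Real.norm_eq_abs]
          refine norm_integral_le_of_norm_le (hwint.mul_const L).integrableOn ?_
          filter_upwards [ae_restrict_mem hs] with x hx
          exact (hnorm x).trans_le (mul_le_mul_of_nonneg_left (hhL x hx) (hw0 x))
      _ = L * ∫ x in s, w x ∂μ := by rw [integral_mul_const, mul_comm]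
      _ ≤ L * C := mul_le_mul_of_nonneg_left hin hL
  · calc |∫ x in sᶜ, w x * (h x - c) ∂μ| ≤ ∫ x in sᶜ, w x * B ∂μ := by
          rw [← Real.norm_eq_abs]
          refine norm_integral_le_of_norm_le (hwint.mul_const B).integrableOn
            (ae_of_all _ fun x => ?_)
          exact (hnorm x).trans_le (mul_le_mul_of_nonneg_left (hhB x) (hw0 x))
      _ = B * ∫ x in sᶜ, w x ∂μ := by rw [integral_mul_const, mul_comm]
      _ ≤ B * η := mul_le_mul_of_nonneg_left hout hB

/-- The integrals over any set of two uniformly `ε`-close bounded functions supported in `[p, q]`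
differ by at most `(q - p) ε`. -/
theorem abs_setIntegral_sub_le_of_support_Icc {F G : ℝ → ℝ} {p q K ε : ℝ} (hpq : p ≤ q)
    (hF : AEStronglyMeasurable F) (hG : AEStronglyMeasurable G)
    (hFK : ∀ a, |F a| ≤ K) (hGK : ∀ a, |G a| ≤ K)
    (hF0 : ∀ a, a ∉ Set.Icc p q → F a = 0) (hG0 : ∀ a, a ∉ Set.Icc p q → G a = 0)
    (hFG : ∀ a, |F a - G a| ≤ ε) (s : Set ℝ) :
    |(∫ a in s, F a) - ∫ a in s, G a| ≤ (q - p) * ε := by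
  have hε : 0 ≤ ε := (abs_nonneg _).trans (hFG p)
  have hind : ∀ D : ℝ, Integrable ((Set.Icc p q).indicator fun _ : ℝ => D) := fun D =>
    (integrable_indicator_iff measurableSet_Icc).2 (integrableOn_const (by simp))
  have hle : ∀ (H : ℝ → ℝ) (D : ℝ), (∀ a, |H a| ≤ D) → (∀ a, a ∉ Set.Icc p q → H a = 0) →
      ∀ a, ‖H a‖ ≤ (Set.Icc p q).indicator (fun _ => D) a := by
    intro H D hH hH0 a
    by_cases ha : a ∈ Set.Icc p q
    · rw [Set.indicator_of_mem ha]
      exact hH a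
    · simp [Set.indicator_of_notMem ha, hH0 a ha]
  have hFi : Integrable F := (hind K).mono' hF (ae_of_all _ (hle F K hFK hF0))
  have hGi : Integrable G := (hind K).mono' hG (ae_of_all _ (hle G K hGK hG0))
  rw [← integral_sub hFi.integrableOn hGi.integrableOn, ← Real.norm_eq_abs]
  calc ‖∫ a in s, (F a - G a)‖ ≤ ∫ a in s, (Set.Icc p q).indicator (fun _ => ε) a := by
        refine norm_integral_le_of_norm_le (hind ε).integrableOn (ae_of_all _ ?_)
        exact hle (fun a => F a - G a) ε hFG fun a ha => by simp [hF0 a ha, hG0 a ha]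
    _ ≤ ∫ a, (Set.Icc p q).indicator (fun _ => ε) a :=
        setIntegral_le_integral (hind ε)
          (ae_of_all _ fun a => Set.indicator_nonneg (fun _ _ => hε) a)
    _ = (q - p) * ε := by
        rw [integral_indicator measurableSet_Icc, setIntegral_const, Measure.real,
          Real.volume_Icc, ENNReal.toReal_ofReal (sub_nonneg.2 hpq), smul_eq_mul]

/-- A function of two real variables that is Lipschitz for the `ℓ¹` distance is continuous. -/
theorem continuous_uncurry_of_abs_sub_le {k : ℝ → ℝ → ℝ} {M : ℝ} (hM : 0 ≤ M)
    (hk : ∀ x x' y y', |k x y - k x' y'| ≤ M * (|x - x'| + |y - y'|)) :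
    Continuous (Function.uncurry k) := by
  refine (LipschitzWith.of_dist_le_mul (K := (2 * M).toNNReal) fun p q => ?_).continuous
  rw [Real.coe_toNNReal _ (by positivity), Real.dist_eq]
  have h1 : |p.1 - q.1| ≤ dist p q := le_max_left _ _
  have h2 : |p.2 - q.2| ≤ dist p q := le_max_right _ _
  calc |k p.1 p.2 - k q.1 q.2| ≤ M * (|p.1 - q.1| + |p.2 - q.2|) := hk _ _ _ _
    _ ≤ M * (dist p q + dist p q) := by gcongr
    _ = 2 * M * dist p q := by ring

/-- Analytic form of Theorem 3 of the paper: bound on the distance between the CDF of the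
Nearest Neighbor Matching (NNM) score and the CDF of the true nonconformity score.
Here `ftil` is the density of the pseudo score (supported on `[u0, u1]`), `k x y` is the
conditional density of the true score at `x` given pseudo score `y` (jointly `M`-Lipschitz,
bounded by `B`, supported in `x` on `[v0, v1]`, with total mass `1` in `x`), and `w · b` is
the (recentred) density of the nearest labeled pseudo score given pseudo score `b`, with
mass at most `C` on `[−δ,δ]` and at most `η` outside. Then for every `t`,
`|∫_{−∞}^t f_nnm − ∫_{−∞}^t f_s| ≤ A (2MδC + Bη)` with `A = 2(u1−u0) + (v1−v0)`. -/
theorem nnm_cdf_bound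
    (M B δ η C u0 u1 v0 v1 : ℝ) (hM : 0 ≤ M) (hB : 0 ≤ B) (hδ : 0 < δ)
    (hη0 : 0 ≤ η) (hη1 : η ≤ 1) (hC0 : 0 ≤ C) (hC1 : C ≤ 1)
    (hu : u0 ≤ u1) (hv : v0 ≤ v1)
    (ftil : ℝ → ℝ) (hft0 : ∀ b, 0 ≤ ftil b) (hftmeas : Measurable ftil)
    (hft1 : (∫ b, ftil b) = 1)
    (hftsupp : ∀ b, b ∉ Set.Icc u0 u1 → ftil b = 0)
    (k : ℝ → ℝ → ℝ)
    (hk0 : ∀ x y, 0 ≤ k x y) (hkB : ∀ x y, k x y ≤ B)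
    (hkLip : ∀ x x' y y', |k x y - k x' y'| ≤ M * (|x - x'| + |y - y'|))
    (hksupp : ∀ y x, x ∉ Set.Icc v0 v1 → k x y = 0)
    (hkint : ∀ y, (∫ x, k x y) = 1)
    (w : ℝ → ℝ → ℝ) (hw0 : ∀ α b, 0 ≤ w α b)
    (hwmeas : Measurable fun p : ℝ × ℝ => w p.1 p.2)
    (hw1 : ∀ b ∈ Set.Icc u0 u1, (∫ α, w α b) = 1)
    (hwin : ∀ b ∈ Set.Icc u0 u1, (∫ α in Set.Icc (-δ) δ, w α b) ≤ C)
    (hwout : ∀ b ∈ Set.Icc u0 u1, (∫ α in (Set.Icc (-δ) δ)ᶜ, w α b) ≤ η)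
    (hwsupp : ∀ b ∈ Set.Icc u0 u1, ∀ α, α ∉ Set.Icc (u0 - b) (u1 - b) → w α b = 0)
    (fnnm fs : ℝ → ℝ)
    (hfnnm : fnnm = fun a => ∫ b, ftil b * ∫ α, w α b * k (a + α) (b + α))
    (hfs : fs = fun a => ∫ b, ftil b * k a b) :
    ∀ t : ℝ,
      |(∫ a in Set.Iic t, fnnm a) - ∫ a in Set.Iic t, fs a| ≤
        (2 * (u1 - u0) + (v1 - v0)) * (2 * M * δ * C + B * η) := by
  intro t
  have hkc : Continuous (Function.uncurry k) := continuous_uncurry_of_abs_sub_le hM hkLip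
  have hkabs : ∀ x y, |k x y| ≤ B := fun x y => by
    rw [abs_of_nonneg (hk0 x y)]
    exact hkB x y
  have hmem : ∀ b, ftil b ≠ 0 → b ∈ Set.Icc u0 u1 := fun b hb =>
    not_not.1 fun hn => hb (hftsupp b hn)
  set g : ℝ → ℝ → ℝ := fun a b => ∫ α, w α b * k (a + α) (b + α) with hg
  have hgmeas : StronglyMeasurable fun p : ℝ × ℝ => g p.1 p.2 := by
    have hm : Measurable fun q : (ℝ × ℝ) × ℝ =>
        w q.2 q.1.2 * k (q.1.1 + q.2) (q.1.2 + q.2) := by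
      have hwm : Measurable fun q : (ℝ × ℝ) × ℝ => w q.2 q.1.2 :=
        hwmeas.comp (measurable_snd.prodMk measurable_fst.snd)
      have hkm : Measurable fun q : (ℝ × ℝ) × ℝ => k (q.1.1 + q.2) (q.1.2 + q.2) :=
        (hkc.comp (g := Function.uncurry k)
          (f := fun q : (ℝ × ℝ) × ℝ => (q.1.1 + q.2, q.1.2 + q.2)) (by fun_prop)).measurable
      exact hwm.mul hkm
    exact hm.stronglyMeasurable.integral_prod_right'
  have hfgm : Measurable fun p : ℝ × ℝ => ftil p.2 * g p.1 p.2 :=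
    (hftmeas.comp measurable_snd).mul hgmeas.measurable
  have hfkm : Measurable fun p : ℝ × ℝ => ftil p.2 * k p.1 p.2 :=
    (hftmeas.comp measurable_snd).mul hkc.measurable
  have hkshift : ∀ a b, Continuous fun α => k (a + α) (b + α) := fun a b =>
    hkc.comp (f := fun α : ℝ => (a + α, b + α)) (by fun_prop)
  have hgabs : ∀ a b, ftil b ≠ 0 → |g a b| ≤ B := by
    intro a b hb
    have h := abs_integral_density_mul_sub_le (μ := volume) (f := fun α => w α b)
      (g := fun α => k (a + α) (b + α)) (h := fun _ => 0) (K := B) (ε := B)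
      (fun α => hw0 α b) (hw1 b (hmem b hb))
      (((hwmeas.comp (measurable_id.prodMk measurable_const)).mul
        (hkshift a b).measurable).aestronglyMeasurable)
      (by simpa using aestronglyMeasurable_const)
      (fun _ _ => hkabs _ _) (fun _ _ => by simpa using hB)
      (fun _ _ => by simpa using hkabs _ _)
    simpa using h
  have hgk : ∀ a b, ftil b ≠ 0 → |g a b - k a b| ≤ 2 * M * δ * C + B * η := by
    intro a b hb
    refine abs_integral_density_mul_sub_const_le measurableSet_Icc (fun α => hw0 α b)
      (hw1 b (hmem b hb)) (hkshift a b).aestronglyMeasurable (by positivity) hB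
      (hwin b (hmem b hb)) (hwout b (hmem b hb)) ?_ ?_
    · intro α hα
      have hα' : |α| ≤ δ := abs_le.2 hα
      have h := hkLip (a + α) a (b + α) b
      rw [add_sub_cancel_left, add_sub_cancel_left] at h
      nlinarith
    · intro α
      rw [abs_le]
      constructor <;>
        linarith [hk0 (a + α) (b + α), hkB (a + α) (b + α), hk0 a b, hkB a b]
  have hsec : ∀ a : ℝ, Measurable fun b : ℝ => (a, b) := fun a => measurable_prodMk_left
  have hbound : ∀ q : ℝ → ℝ, (∀ b, ftil b ≠ 0 → |q b| ≤ B) →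
      Measurable (fun b => ftil b * q b) → |∫ b, ftil b * q b| ≤ B := by
    intro q hq hqm
    have h := abs_integral_density_mul_sub_le (μ := volume) (f := ftil) (g := q)
      (h := fun _ => 0) (K := B) (ε := B) hft0 hft1 hqm.aestronglyMeasurable
      (by simpa using aestronglyMeasurable_const) hq (fun _ _ => by simpa using hB)
      (fun b hb => by simpa using hq b hb)
    simpa using h
  have hA : 2 * (u1 - u0) + (v1 - v0) = (v1 + (u1 - u0)) - (v0 - (u1 - u0)) := by ring
  rw [hA, hfnnm, hfs]
  refine abs_setIntegral_sub_le_of_support_Icc (K := B) (by linarith)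
    hfgm.stronglyMeasurable.integral_prod_right'.aestronglyMeasurable
    hfkm.stronglyMeasurable.integral_prod_right'.aestronglyMeasurable
    (fun a => hbound _ (hgabs a) (hfgm.comp (hsec a)))
    (fun a => hbound _ (fun b _ => hkabs a b) (hfkm.comp (hsec a))) ?_ ?_ ?_ _
  · intro a ha
    refine integral_eq_zero_of_ae (ae_of_all _ fun b => ?_)
    by_cases hb : ftil b = 0
    · simp [hb]
    · have hbm := hmem b hb
      have hg0 : g a b = 0 := by
        refine integral_eq_zero_of_ae (ae_of_all _ fun α => ?_)
        by_cases hα : α ∈ Set.Icc (u0 - b) (u1 - b)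
        · have hk' : k (a + α) (b + α) = 0 := by
            refine hksupp _ _ fun hm => ha ⟨?_, ?_⟩ <;>
              linarith [hm.1, hm.2, hα.1, hα.2, hbm.1, hbm.2]
          simp [hk']
        · simp [hwsupp b hbm α hα]
      simpa [hb] using hg0
  · intro a ha
    refine integral_eq_zero_of_ae (ae_of_all _ fun b => ?_)
    have hk' : k a b = 0 :=
      hksupp _ _ fun hm => ha ⟨by linarith [hm.1], by linarith [hm.2]⟩
    simp [hk']
  · intro a
    exact abs_integral_density_mul_sub_le hft0 hft1
      (hfgm.comp (hsec a)).aestronglyMeasurable (hfkm.comp (hsec a)).aestronglyMeasurable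
      (hgabs a) (fun b _ => hkabs a b) (hgk a)
end
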